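/- On the interval (−1,0) the functions Ī₀ and Ī₂ are differentiable and satisfy the Picard–Fuchs system: for every h ∈ (−1,0), 4h(1+h) Ī₀′(h) = (4+3h) Ī₀(h) − 5 Ī₂(h) and 4h(1+h) Ī₂′(h) = −h Ī₀(h) + 5h Ī₂(h). -/

import Mathlib

open intervalIntegral Real

/-- `Ī_k(h) = ∫_{u₁(h)}^{u₂(h)} u^k √(h + 2u² − u⁴) du` where
`u₁(h) = √(1 − √(1+h))` and `u₂(h) = √(1 + √(1+h))`. -/
noncomputable def Ibar (k : ℕ) (h : ℝ) : ℝ :=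
  ∫ u in (Real.sqrt (1 - Real.sqrt (1 + h)))..(Real.sqrt (1 + Real.sqrt (1 + h))),
    u ^ k * Real.sqrt (h + 2 * u ^ 2 - u ^ 4)

/-- The integral `∫ (1 + s sin θ) ^ p dθ` over `[-π/2, π/2]`. -/
noncomputable def sinPowIntegral (p s : ℝ) : ℝ :=
  ∫ θ in (-(π / 2))..(π / 2), (1 + s * sin θ) ^ p

/-- The integral `∫ cos² θ (1 + s sin θ) ^ p dθ` over `[-π/2, π/2]`. -/
noncomputable def cosSqSinPowIntegral (p s : ℝ) : ℝ :=
  ∫ θ in (-(π / 2))..(π / 2), cos θ ^ 2 * (1 + s * sin θ) ^ p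

lemma one_add_mul_sin_pos {s : ℝ} (hs : s ∈ Set.Ioo (0 : ℝ) 1) (θ : ℝ) : 0 < 1 + s * sin θ := by
  nlinarith [hs.1, hs.2, neg_one_le_sin θ]

lemma continuous_one_add_mul_sin_rpow {s : ℝ} (hs : s ∈ Set.Ioo (0 : ℝ) 1) (p : ℝ) :
    Continuous fun θ => (1 + s * sin θ) ^ p :=
  (by fun_prop : Continuous fun θ => 1 + s * sin θ).rpow_const
    fun θ => .inl (one_add_mul_sin_pos hs θ).ne'

lemma hasDerivAt_one_add_mul_sin_rpow {s : ℝ} (hs : s ∈ Set.Ioo (0 : ℝ) 1) (p θ : ℝ) :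
    HasDerivAt (fun θ => (1 + s * sin θ) ^ p) (s * cos θ * p * (1 + s * sin θ) ^ (p - 1)) θ :=
  (((hasDerivAt_sin θ).const_mul s).const_add 1).rpow_const
    (.inl (one_add_mul_sin_pos hs θ).ne')

lemma one_add_mul_sin_rpow_add_one {s : ℝ} (hs : s ∈ Set.Ioo (0 : ℝ) 1) (p θ : ℝ) :
    (1 + s * sin θ) ^ (p + 1) = (1 + s * sin θ) ^ p * (1 + s * sin θ) :=
  rpow_add_one (one_add_mul_sin_pos hs θ).ne' p

lemma hasDerivAt_cosSqSinPowIntegral {s : ℝ} (hs : s ∈ Set.Ioo (0 : ℝ) 1) (p : ℝ) :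
    HasDerivAt (cosSqSinPowIntegral p)
      (∫ θ in (-(π / 2))..(π / 2), cos θ ^ 2 * (sin θ * p * (1 + s * sin θ) ^ (p - 1))) s := by
  obtain ⟨a, ha, has⟩ := exists_between hs.1
  obtain ⟨b, hsb, hb⟩ := exists_between hs.2
  have hsub : ∀ x ∈ Set.Icc a b, x ∈ Set.Ioo (0 : ℝ) 1 := fun x hx =>
    ⟨ha.trans_le hx.1, hx.2.trans_lt hb⟩
  have hcont : ContinuousOn
      (fun q : ℝ × ℝ => cos q.2 ^ 2 * (sin q.2 * p * (1 + q.1 * sin q.2) ^ (p - 1)))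
      (Set.Icc a b ×ˢ Set.Icc (-(π / 2)) (π / 2)) := by
    have hW : ContinuousOn (fun q : ℝ × ℝ => (1 + q.1 * sin q.2) ^ (p - 1))
        (Set.Icc a b ×ˢ Set.Icc (-(π / 2)) (π / 2)) :=
      ContinuousOn.rpow_const (by fun_prop) fun q hq =>
        .inl (one_add_mul_sin_pos (hsub _ hq.1) _).ne'
    fun_prop
  obtain ⟨C, hC⟩ := (isCompact_Icc.prod isCompact_Icc).exists_bound_of_continuousOn hcont
  have hcosF : ∀ x ∈ Set.Ioo (0 : ℝ) 1,
      Continuous fun θ => cos θ ^ 2 * (1 + x * sin θ) ^ p := fun x hx =>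
    (continuous_cos.pow 2).mul (continuous_one_add_mul_sin_rpow hx p)
  refine (intervalIntegral.hasDerivAt_integral_of_dominated_loc_of_deriv_le
    (F := fun x θ => cos θ ^ 2 * (1 + x * sin θ) ^ p)
    (F' := fun x θ => cos θ ^ 2 * (sin θ * p * (1 + x * sin θ) ^ (p - 1)))
    (bound := fun _ => C) (Icc_mem_nhds has hsb) ?_ ((hcosF s hs).intervalIntegrable _ _) ?_ ?_
    intervalIntegrable_const ?_).2
  · filter_upwards [Ioo_mem_nhds hs.1 hs.2] with x hx
    exact (hcosF x hx).aestronglyMeasurable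
  · exact ((continuous_cos.pow 2).mul ((continuous_sin.mul continuous_const).mul
      (continuous_one_add_mul_sin_rpow hs _))).aestronglyMeasurable
  · refine .of_forall fun θ hθ x hx => hC (x, θ) ⟨hx, ?_⟩
    rw [Set.uIoc_of_le (by linarith [pi_pos])] at hθ
    exact ⟨hθ.1.le, hθ.2⟩
  · refine .of_forall fun θ _ x hx => ?_
    have h := ((hasDerivAt_mul_const (sin θ) (x := x)).const_add 1).rpow_const (p := p)
      (.inl (one_add_mul_sin_pos (hsub x hx) θ).ne')
    exact h.const_mul (cos θ ^ 2)

lemma integral_cosSq_mul_sin_mul_rpow {s : ℝ} (hs : s ∈ Set.Ioo (0 : ℝ) 1) (p : ℝ) :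
    s * (∫ θ in (-(π / 2))..(π / 2), cos θ ^ 2 * (sin θ * p * (1 + s * sin θ) ^ (p - 1))) =
      sinPowIntegral p s - 2 * cosSqSinPowIntegral p s := by
  have hW := continuous_one_add_mul_sin_rpow hs p
  have hW' := continuous_one_add_mul_sin_rpow hs (p - 1)
  have hG : ∀ θ ∈ Set.uIcc (-(π / 2)) (π / 2), HasDerivAt
      (fun θ => cos θ * sin θ * (1 + s * sin θ) ^ p)
      (s * (cos θ ^ 2 * (sin θ * p * (1 + s * sin θ) ^ (p - 1))) - (1 + s * sin θ) ^ p
        + 2 * (cos θ ^ 2 * (1 + s * sin θ) ^ p)) θ := fun θ _ => by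
    convert! ((hasDerivAt_cos θ).mul (hasDerivAt_sin θ)).mul
      (hasDerivAt_one_add_mul_sin_rpow hs p θ) using 1
    rw [Pi.mul_apply]
    linear_combination (1 + s * sin θ) ^ p * sin_sq_add_cos_sq θ
  have h := integral_eq_sub_of_hasDerivAt hG (Continuous.intervalIntegrable (by fun_prop) _ _)
  rw [integral_add (Continuous.intervalIntegrable (by fun_prop) _ _)
      (Continuous.intervalIntegrable (by fun_prop) _ _),
    integral_sub (Continuous.intervalIntegrable (by fun_prop) _ _)
      (Continuous.intervalIntegrable (by fun_prop) _ _),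
    integral_const_mul, integral_const_mul] at h
  simp only [cos_neg, cos_pi_div_two, zero_mul, sub_zero] at h
  unfold sinPowIntegral cosSqSinPowIntegral
  linarith

lemma sq_mul_cosSqSinPowIntegral {s : ℝ} (hs : s ∈ Set.Ioo (0 : ℝ) 1) (p : ℝ) :
    (p + 2) * s ^ 2 * cosSqSinPowIntegral p s =
      sinPowIntegral (p + 1) s - (1 - s ^ 2) * sinPowIntegral p s := by
  have hW := continuous_one_add_mul_sin_rpow hs p
  have hW' := continuous_one_add_mul_sin_rpow hs (p + 1)
  have hG : ∀ θ ∈ Set.uIcc (-(π / 2)) (π / 2), HasDerivAt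
      (fun θ => s * cos θ * (1 + s * sin θ) ^ (p + 1))
      ((p + 2) * s ^ 2 * (cos θ ^ 2 * (1 + s * sin θ) ^ p) - (1 + s * sin θ) ^ (p + 1)
        + (1 - s ^ 2) * (1 + s * sin θ) ^ p) θ := fun θ _ => by
    convert! ((hasDerivAt_cos θ).const_mul s).mul
      (hasDerivAt_one_add_mul_sin_rpow hs (p + 1) θ) using 1
    rw [add_sub_cancel_right, one_add_mul_sin_rpow_add_one hs]
    linear_combination s ^ 2 * (1 + s * sin θ) ^ p * sin_sq_add_cos_sq θ
  have h := integral_eq_sub_of_hasDerivAt hG (Continuous.intervalIntegrable (by fun_prop) _ _)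
  rw [integral_add (Continuous.intervalIntegrable (by fun_prop) _ _)
      (Continuous.intervalIntegrable (by fun_prop) _ _),
    integral_sub (Continuous.intervalIntegrable (by fun_prop) _ _)
      (Continuous.intervalIntegrable (by fun_prop) _ _),
    integral_const_mul, integral_const_mul] at h
  simp only [cos_neg, cos_pi_div_two, zero_mul, mul_zero, sub_zero] at h
  unfold sinPowIntegral cosSqSinPowIntegral
  linarith

lemma cosSqSinPowIntegral_add_one {s : ℝ} (hs : s ∈ Set.Ioo (0 : ℝ) 1) (p : ℝ) :
    (p + 3) * cosSqSinPowIntegral (p + 1) s =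
      sinPowIntegral (p + 1) s + (p + 1) * cosSqSinPowIntegral p s := by
  have hW := continuous_one_add_mul_sin_rpow hs p
  have hW' := continuous_one_add_mul_sin_rpow hs (p + 1)
  have h := integral_cosSq_mul_sin_mul_rpow hs (p + 1)
  have hsplit : s * (∫ θ in (-(π / 2))..(π / 2),
      cos θ ^ 2 * (sin θ * (p + 1) * (1 + s * sin θ) ^ (p + 1 - 1))) =
      (p + 1) * (cosSqSinPowIntegral (p + 1) s - cosSqSinPowIntegral p s) := by
    unfold cosSqSinPowIntegral
    rw [← integral_sub (Continuous.intervalIntegrable (by fun_prop) _ _)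
      (Continuous.intervalIntegrable (by fun_prop) _ _), ← integral_const_mul,
      ← integral_const_mul]
    congr 1 with θ
    rw [add_sub_cancel_right, one_add_mul_sin_rpow_add_one hs]
    ring
  linarith

lemma Ibar_eq_cosSqSinPowIntegral (k : ℕ) {h : ℝ} (hh : h ∈ Set.Ioo (-1 : ℝ) 0) :
    Ibar k h = (1 + h) / 2 * cosSqSinPowIntegral ((k - 1) / 2) (√(1 + h)) := by
  set s := √(1 + h) with hs_def
  have hsq : s ^ 2 = 1 + h := sq_sqrt (by linarith [hh.1])
  have hs : s ∈ Set.Ioo (0 : ℝ) 1 :=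
    ⟨sqrt_pos.2 (by linarith [hh.1]), by
      rw [hs_def, sqrt_lt' one_pos]; linarith [hh.2]⟩
  have hsubst := integral_comp_mul_deriv (a := -(π / 2)) (b := π / 2)
    (f := fun θ => √(1 + s * sin θ)) (f' := fun θ => s * cos θ / (2 * √(1 + s * sin θ)))
    (g := fun u => u ^ k * √(h + 2 * u ^ 2 - u ^ 4))
    (fun θ _ => (((hasDerivAt_sin θ).const_mul s).const_add 1).sqrt
      (one_add_mul_sin_pos hs θ).ne')
    (Continuous.continuousOn (Continuous.div (by fun_prop) (by fun_prop) fun θ =>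
      (mul_pos two_pos (sqrt_pos.2 (one_add_mul_sin_pos hs θ))).ne'))
    (by fun_prop)
  simp only [sin_neg, sin_pi_div_two, mul_neg, mul_one, ← sub_eq_add_neg] at hsubst
  rw [Ibar, ← hs_def, ← hsubst, cosSqSinPowIntegral, ← integral_const_mul]
  refine integral_congr fun θ hθ => ?_
  rw [Set.uIcc_of_le (by linarith [pi_pos])] at hθ
  have hcos : 0 ≤ cos θ := cos_nonneg_of_mem_Icc hθ
  have hW := one_add_mul_sin_pos hs θ
  have hroot : √(h + 2 * √(1 + s * sin θ) ^ 2 - √(1 + s * sin θ) ^ 4) = s * cos θ := by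
    rw [← sqrt_sq (mul_nonneg hs.1.le hcos)]
    congr 1
    rw [show √(1 + s * sin θ) ^ 4 = (√(1 + s * sin θ) ^ 2) ^ 2 by ring, sq_sqrt hW.le]
    linear_combination -hsq - s ^ 2 * sin_sq_add_cos_sq θ
  have hpow : (1 + s * sin θ) ^ (((k : ℝ) - 1) / 2)
      = √(1 + s * sin θ) ^ k / √(1 + s * sin θ) := by
    rw [sub_div, rpow_sub hW, ← sqrt_eq_rpow, sqrt_eq_rpow, ← rpow_mul_natCast hW.le]
    ring_nf
  have hne : √(1 + s * sin θ) ≠ 0 := (sqrt_pos.2 hW).ne'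
  simp only [Function.comp]
  rw [hroot, hpow, ← hsq]
  field_simp

lemma hasDerivAt_Ibar (k : ℕ) {h : ℝ} (hh : h ∈ Set.Ioo (-1 : ℝ) 0) :
    HasDerivAt (Ibar k) (sinPowIntegral ((k - 1) / 2) (√(1 + h)) / 4) h := by
  have hpos : 0 < 1 + h := by linarith [hh.1]
  have hs : √(1 + h) ∈ Set.Ioo (0 : ℝ) 1 :=
    ⟨sqrt_pos.2 hpos, by rw [sqrt_lt' one_pos]; linarith [hh.2]⟩
  have hlin : HasDerivAt (fun x : ℝ => 1 + x) 1 h := (hasDerivAt_id h).const_add 1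
  have hd := (hlin.div_const 2).mul ((hasDerivAt_cosSqSinPowIntegral hs ((k - 1) / 2)).comp h
    (hlin.sqrt hpos.ne'))
  refine HasDerivAt.congr_of_eventuallyEq (f := _) (hd.congr_deriv ?_) ?_
  · have hparts := integral_cosSq_mul_sin_mul_rpow hs ((k - 1) / 2)
    have hsq : √(1 + h) ^ 2 = 1 + h := sq_sqrt hpos.le
    have hne := hs.1.ne'
    simp only [Function.comp]
    generalize (∫ θ in _.._, _ : ℝ) = D at hparts ⊢
    generalize √(1 + h) = s at hparts hsq hne ⊢
    rw [← hsq]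
    field_simp
    linarith
  · filter_upwards [Ioo_mem_nhds hh.1 hh.2] with x hx
    exact Ibar_eq_cosSqSinPowIntegral k hx

/-- On `(−1,0)` the functions `Ī₀` and `Ī₂` are differentiable and satisfy
the Picard–Fuchs system `4h(1+h) Ī₀′(h) = (4+3h) Ī₀(h) − 5 Ī₂(h)` and
`4h(1+h) Ī₂′(h) = −h Ī₀(h) + 5h Ī₂(h)`. -/
theorem stmt6 :
    ∀ h ∈ Set.Ioo (-1 : ℝ) 0,
      DifferentiableAt ℝ (Ibar 0) h ∧ DifferentiableAt ℝ (Ibar 2) h ∧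
      4 * h * (1 + h) * deriv (Ibar 0) h = (4 + 3 * h) * Ibar 0 h - 5 * Ibar 2 h ∧
      4 * h * (1 + h) * deriv (Ibar 2) h = -h * Ibar 0 h + 5 * h * Ibar 2 h := by
  intro h hh
  have hpos : 0 < 1 + h := by linarith [hh.1]
  have hs : √(1 + h) ∈ Set.Ioo (0 : ℝ) 1 :=
    ⟨sqrt_pos.2 hpos, by rw [sqrt_lt' one_pos]; linarith [hh.2]⟩
  have hsq : √(1 + h) ^ 2 = 1 + h := sq_sqrt hpos.le
  have hd₀ := hasDerivAt_Ibar 0 hh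
  have hd₂ := hasDerivAt_Ibar 2 hh
  refine ⟨hd₀.differentiableAt, hd₂.differentiableAt, ?_⟩
  rw [hd₀.deriv, hd₂.deriv, Ibar_eq_cosSqSinPowIntegral 0 hh, Ibar_eq_cosSqSinPowIntegral 2 hh]
  have hrel := sq_mul_cosSqSinPowIntegral hs (-1 / 2)
  have hrec := cosSqSinPowIntegral_add_one hs (-1 / 2)
  rw [hsq] at hrel
  norm_num at hrel hrec ⊢
  constructor
  · linear_combination (-(1 + h)) * hrel + (1 + h) * hrec
  · linear_combination (-h * (1 + h)) * hrec
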